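/- (Uniqueness of the continuity equation along characteristics.) Let σ ≤ τ, let X : [σ,τ] → ℝ^d be a characteristic curve of u, and let ρ₁, ρ₂ be two differentiable functions, each solving the continuity equation at every point (t, X(t)) with t ∈ [σ,τ], and suppose t ↦ (div_x u)(t, X(t)) is continuous on [σ,τ]. If ρ₁(σ, X(σ)) = ρ₂(σ, X(σ)), then ρ₁(τ, X(τ)) = ρ₂(τ, X(τ)). -/

import Mathlib

open MeasureTheory Set Filter

/-- The spatial divergence of a time-dependent velocity field
`u : ℝ × ℝ^d → ℝ^d`: `(div_x u)(t,x) = ∑ i, ∂uᵢ/∂xᵢ(t,x)`. -/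
noncomputable def spatialDiv (d : ℕ) (u : ℝ × (Fin d → ℝ) → (Fin d → ℝ))
    (t : ℝ) (x : Fin d → ℝ) : ℝ :=
  ∑ i : Fin d, fderiv ℝ (fun y => u (t, y) i) x (Pi.single i 1)

/-- `ρ` solves the continuity equation at `(t,x)`:
`∂ₜρ(t,x) + u(t,x)·∇ₓρ(t,x) + ρ(t,x)·(div_x u)(t,x) = 0`. -/
noncomputable def SolvesContinuityAt (d : ℕ) (u : ℝ × (Fin d → ℝ) → (Fin d → ℝ))
    (ρ : ℝ × (Fin d → ℝ) → ℝ) (t : ℝ) (x : Fin d → ℝ) : Prop :=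
  fderiv ℝ ρ (t, x) ((1 : ℝ), (0 : Fin d → ℝ))
    + fderiv ℝ ρ (t, x) ((0 : ℝ), u (t, x))
    + ρ (t, x) * spatialDiv d u t x = 0

/-- The derivative of a differentiable solution of the continuity equation along a
characteristic. -/
lemma SolvesContinuityAt.hasDerivAt_comp {d : ℕ} {u : ℝ × (Fin d → ℝ) → (Fin d → ℝ)}
    {ρ : ℝ × (Fin d → ℝ) → ℝ} {X : ℝ → (Fin d → ℝ)} {t : ℝ}
    (h : SolvesContinuityAt d u ρ t (X t)) (hρ : DifferentiableAt ℝ ρ (t, X t))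
    (hX : HasDerivAt X (u (t, X t)) t) :
    HasDerivAt (fun s => ρ (s, X s)) (-spatialDiv d u t (X t) * ρ (t, X t)) t := by
  have hcomp := hρ.hasFDerivAt.comp_hasDerivAt t ((hasDerivAt_id t).prodMk hX)
  refine hcomp.congr_deriv ?_
  have hsplit : ((1 : ℝ), u (t, X t)) = ((1 : ℝ), (0 : Fin d → ℝ)) + ((0 : ℝ), u (t, X t)) := by
    simp
  rw [hsplit, map_add]
  unfold SolvesContinuityAt at h
  linarith

/-- Uniqueness of the continuity equation along characteristics:
two differentiable solutions of the continuity equation along the same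
characteristic that agree at time `σ` agree at time `τ`. -/
theorem density_uniqueness_along_characteristic
    (d : ℕ) (hd : 1 ≤ d)
    (u : ℝ × (Fin d → ℝ) → (Fin d → ℝ))
    (hu : ∀ (t : ℝ) (x : Fin d → ℝ), DifferentiableAt ℝ (fun y => u (t, y)) x)
    (ρ₁ ρ₂ : ℝ × (Fin d → ℝ) → ℝ) (hρ₁ : Differentiable ℝ ρ₁) (hρ₂ : Differentiable ℝ ρ₂)
    (σ τ : ℝ) (hστ : σ ≤ τ) (X : ℝ → (Fin d → ℝ))
    (hX : ∀ t ∈ Set.Icc σ τ, HasDerivAt X (u (t, X t)) t)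
    (hce₁ : ∀ t ∈ Set.Icc σ τ, SolvesContinuityAt d u ρ₁ t (X t))
    (hce₂ : ∀ t ∈ Set.Icc σ τ, SolvesContinuityAt d u ρ₂ t (X t))
    (hcont : ContinuousOn (fun t => spatialDiv d u t (X t)) (Set.Icc σ τ))
    (hσ : ρ₁ (σ, X σ) = ρ₂ (σ, X σ)) :
    ρ₁ (τ, X τ) = ρ₂ (τ, X τ) := by
  obtain ⟨C, hC⟩ := isCompact_Icc.exists_bound_of_continuousOn hcont
  have hd₁ := fun t ht => (hce₁ t ht).hasDerivAt_comp (hρ₁ _) (hX t ht)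
  have hd₂ := fun t ht => (hce₂ t ht).hasDerivAt_comp (hρ₂ _) (hX t ht)
  refine ODE_solution_unique_of_mem_Icc_right (K := C.toNNReal) (s := fun _ => univ)
    (v := fun t y => -spatialDiv d u t (X t) * y) (fun t ht => ?_)
    (fun t ht => (hd₁ t ht).continuousAt.continuousWithinAt)
    (fun t ht => (hd₁ t (Ico_subset_Icc_self ht)).hasDerivWithinAt) (fun _ _ => mem_univ _)
    (fun t ht => (hd₂ t ht).continuousAt.continuousWithinAt)
    (fun t ht => (hd₂ t (Ico_subset_Icc_self ht)).hasDerivWithinAt) (fun _ _ => mem_univ _)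
    hσ (right_mem_Icc.2 hστ)
  refine LipschitzOnWith.of_dist_le_mul fun x _ y _ => ?_
  rw [Real.dist_eq, Real.dist_eq, ← mul_sub, abs_mul, abs_neg]
  gcongr
  exact (hC t (Ico_subset_Icc_self ht)).trans (Real.le_coe_toNNReal C)
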